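/- Let H : 𝕋ⁿ × ℝⁿ → ℝ be a Tonelli Hamiltonian and let T₀ and T₁ be two Lipschitz Lagrangian graphs in 𝕋ⁿ × ℝⁿ, each invariant under the Hamiltonian flow of H, and each Schwartzman strictly ergodic with the same rotation vector ω ∈ ℝⁿ. Then T₀ = T₁. -/

import Mathlib

/-!
STATEMENT 8 (Fathi–Giuliani–Sorrentino: two Lipschitz Lagrangian graphs
invariant under the flow of a Tonelli Hamiltonian and Schwartzman strictly
ergodic with the same rotation vector coincide).

The torus is `𝕋ⁿ = ℝⁿ/ℤⁿ`, realized as `Fin n → AddCircle 1`; the Hamiltonian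
and its flow are described on the universal cover `ℝⁿ × ℝⁿ` by `ℤⁿ`-periodic
(resp. equivariant) data, and measures live downstairs on `𝕋ⁿ × ℝⁿ`.
-/

open MeasureTheory

/-- `v ∈ ℝⁿ` is an integer vector. -/
def IsIntVec {n : ℕ} (v : Fin n → ℝ) : Prop := ∀ i, ∃ m : ℤ, v i = (m : ℝ)

/-- The vertical gradient `∇_I H (θ, I)`. -/
noncomputable def gradI {n : ℕ} (H : (Fin n → ℝ) → (Fin n → ℝ) → ℝ)
    (θ I : Fin n → ℝ) : Fin n → ℝ :=
  fun i => fderiv ℝ (H θ) I (Pi.single i 1)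

/-- The horizontal gradient `∇_θ H (θ, I)`. -/
noncomputable def gradTheta {n : ℕ} (H : (Fin n → ℝ) → (Fin n → ℝ) → ℝ)
    (θ I : Fin n → ℝ) : Fin n → ℝ :=
  fun i => fderiv ℝ (fun t => H t I) θ (Pi.single i 1)

/-- The gradient `∇ u` of a scalar function on `ℝⁿ`. -/
noncomputable def gradOf {n : ℕ} (u : (Fin n → ℝ) → ℝ) (x : Fin n → ℝ) :
    Fin n → ℝ :=
  fun i => fderiv ℝ u x (Pi.single i 1)

/-- `H` (given on the cover, `ℤⁿ`-periodic in `θ`) is a Tonelli Hamiltonian: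
smooth, with uniformly positive definite Hessian in the `I` variables (A1),
and superlinear in `I` (A2). -/
def IsTonelli {n : ℕ} (H : (Fin n → ℝ) → (Fin n → ℝ) → ℝ) : Prop :=
  ContDiff ℝ (⊤ : ℕ∞) (Function.uncurry H) ∧
  (∀ θ I v, IsIntVec v → H (θ + v) I = H θ I) ∧
  (∃ c > (0:ℝ), ∀ θ I (w : Fin n → ℝ),
    c * ‖w‖ ^ 2 ≤ iteratedFDeriv ℝ 2 (H θ) I ![w, w]) ∧
  (∀ θ, ∀ C : ℝ, ∃ R : ℝ, ∀ I : Fin n → ℝ, R ≤ ‖I‖ → C * ‖I‖ ≤ H θ I)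

/-- `φ` is the flow on the cover `ℝⁿ × ℝⁿ` of the Hamiltonian vector field
`X^H = (∇_I H, −∇_θ H)`. -/
def IsHamFlow {n : ℕ} (H : (Fin n → ℝ) → (Fin n → ℝ) → ℝ)
    (φ : ℝ → (Fin n → ℝ) × (Fin n → ℝ) → (Fin n → ℝ) × (Fin n → ℝ)) : Prop :=
  (∀ p, φ 0 p = p) ∧
  ∀ p t, HasDerivAt (fun τ => φ τ p)
    (gradI H (φ t p).1 (φ t p).2, -gradTheta H (φ t p).1 (φ t p).2) t

/-- Projection from the cover `ℝⁿ × ℝⁿ` to `𝕋ⁿ × ℝⁿ`. -/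
noncomputable def projT (n : ℕ) : (Fin n → ℝ) × (Fin n → ℝ) →
    (Fin n → AddCircle (1:ℝ)) × (Fin n → ℝ) :=
  fun p => (fun i => (p.1 i : AddCircle (1:ℝ)), p.2)

/-- The Lipschitz Lagrangian graph in `𝕋ⁿ × ℝⁿ` of `ψ = c + ∇u`. -/
noncomputable def lagGraph {n : ℕ} (c : Fin n → ℝ) (u : (Fin n → ℝ) → ℝ) :
    Set ((Fin n → AddCircle (1:ℝ)) × (Fin n → ℝ)) :=
  projT n '' {p : (Fin n → ℝ) × (Fin n → ℝ) | p.2 = c + gradOf u p.1}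

/-- `u : 𝕋ⁿ → ℝ` (given on the cover) is `C¹` with Lipschitz gradient. -/
def IsC1LipGrad {n : ℕ} (u : (Fin n → ℝ) → ℝ) : Prop :=
  (∀ x v, IsIntVec v → u (x + v) = u x) ∧ ContDiff ℝ 1 u ∧
  ∃ K : NNReal, LipschitzWith K (gradOf u)

/-- The compact invariant set `T ⊆ 𝕋ⁿ × ℝⁿ` is Schwartzman strictly ergodic
with rotation vector `ω` for the (descended) Hamiltonian flow `Φ` of `H`:
every `Φ`-invariant Borel probability measure carried by `T` has Schwartzman
asymptotic cycle `∫ ∇_I H dμ = ω`, and at least one such measure has support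
equal to `T`.  (The integrand is the function on `𝕋ⁿ × ℝⁿ` descending
`∇_I H`.) -/
def SchwartzmanStrictlyErgodic {n : ℕ}
    (H : (Fin n → ℝ) → (Fin n → ℝ) → ℝ)
    (Φ : ℝ → (Fin n → AddCircle (1:ℝ)) × (Fin n → ℝ) →
      (Fin n → AddCircle (1:ℝ)) × (Fin n → ℝ))
    (T : Set ((Fin n → AddCircle (1:ℝ)) × (Fin n → ℝ))) (ω : Fin n → ℝ) : Prop :=
  (∀ μ : Measure ((Fin n → AddCircle (1:ℝ)) × (Fin n → ℝ)),
    IsProbabilityMeasure μ → (∀ t, μ.map (Φ t) = μ) → μ T = 1 →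
    ∀ g : (Fin n → AddCircle (1:ℝ)) × (Fin n → ℝ) → (Fin n → ℝ),
      Continuous g → (∀ p, g (projT n p) = gradI H p.1 p.2) →
      ∫ q, g q ∂μ = ω) ∧
  ∃ μ : Measure ((Fin n → AddCircle (1:ℝ)) × (Fin n → ℝ)),
    IsProbabilityMeasure μ ∧ (∀ t, μ.map (Φ t) = μ) ∧ μ T = 1 ∧
    ∀ U : Set ((Fin n → AddCircle (1:ℝ)) × (Fin n → ℝ)),
      IsOpen U → (U ∩ T).Nonempty → 0 < μ U

open Set Filter Topology

section LinearAlgebra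

variable {n : ℕ}

lemma clm_apply_eq_dotProduct (L : (Fin n → ℝ) →L[ℝ] ℝ) (v : Fin n → ℝ) :
    L v = (fun i => L (Pi.single i 1)) ⬝ᵥ v := by
  conv_lhs => rw [pi_eq_sum_univ' v]
  simp [dotProduct, mul_comm]

lemma abs_dotProduct_le (a b : Fin n → ℝ) : |a ⬝ᵥ b| ≤ n * (‖a‖ * ‖b‖) := by
  calc |a ⬝ᵥ b| ≤ ∑ i, |a i * b i| := Finset.abs_sum_le_sum_abs _ _
    _ ≤ ∑ _i : Fin n, ‖a‖ * ‖b‖ := by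
        refine Finset.sum_le_sum fun i _ => ?_
        rw [abs_mul]
        exact mul_le_mul (norm_le_pi_norm a i) (norm_le_pi_norm b i) (abs_nonneg _)
          (norm_nonneg _)
    _ = n * (‖a‖ * ‖b‖) := by simp

lemma hasDerivAt_dotProduct {a b : ℝ → Fin n → ℝ} {a' b' : Fin n → ℝ} {t : ℝ}
    (ha : HasDerivAt a a' t) (hb : HasDerivAt b b' t) :
    HasDerivAt (fun s => a s ⬝ᵥ b s) (a' ⬝ᵥ b t + a t ⬝ᵥ b') t := by
  rw [hasDerivAt_pi] at ha hb
  simp only [dotProduct, ← Finset.sum_add_distrib]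
  exact HasDerivAt.fun_sum fun i _ => (ha i).mul (hb i)

lemma norm_image_sub_fderiv_le {E : Type*} [NormedAddCommGroup E] [NormedSpace ℝ E]
    {f : E → ℝ} {s : Set E} (hs : Convex ℝ s) (hf : Differentiable ℝ f) {L : NNReal}
    (hL : LipschitzOnWith L (fderiv ℝ f) s) {x y : E} (hx : x ∈ s) (hy : y ∈ s) :
    |f y - f x - fderiv ℝ f x (y - x)| ≤ L * ‖y - x‖ ^ 2 := by
  have hseg : segment ℝ x y ⊆ s := hs.segment_subset hx hy
  have h := (convex_segment x y).norm_image_sub_le_of_norm_fderiv_le' (f := f)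
    (φ := fderiv ℝ f x) (C := L * ‖y - x‖) (fun z _ => hf z) (fun z hz => by
      refine (hL.norm_sub_le (hseg hz) hx).trans ?_
      gcongr
      simpa [norm_sub_rev] using norm_sub_le_of_mem_segment hz)
    (left_mem_segment ℝ x y) (right_mem_segment ℝ x y)
  simpa [pow_two, mul_assoc] using h

end LinearAlgebra

section Periodic

variable {n : ℕ}

/-- `F` is `ℤⁿ`-periodic in the first variable. -/
def IsAnglePeriodic {E : Type*} (F : (Fin n → ℝ) × (Fin n → ℝ) → E) : Prop :=
  ∀ p v, IsIntVec v → F (p.1 + v, p.2) = F p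

lemma projT_eq_iff {p q : (Fin n → ℝ) × (Fin n → ℝ)} :
    projT n p = projT n q ↔ ∃ v, IsIntVec v ∧ p = (q.1 + v, q.2) := by
  constructor
  · intro h
    refine ⟨p.1 - q.1, fun i => ?_, ?_⟩
    · have h1 : ((p.1 i : ℝ) : AddCircle (1 : ℝ)) = (q.1 i : ℝ) := congrFun (congrArg Prod.fst h) i
      rw [← sub_eq_zero, ← AddCircle.coe_sub, AddCircle.coe_eq_zero_iff] at h1
      obtain ⟨m, hm⟩ := h1
      exact ⟨m, by simpa using hm.symm⟩
    · have h2 := congrArg Prod.snd h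
      exact Prod.ext (by simp) h2
  · rintro ⟨v, hv, rfl⟩
    refine Prod.ext (funext fun i => ?_) rfl
    obtain ⟨m, hm⟩ := hv i
    have h0 : ((m : ℝ) : AddCircle (1 : ℝ)) = 0 :=
      (AddCircle.coe_eq_zero_iff 1).2 ⟨m, by simp⟩
    simp [projT, hm, h0]

lemma isOpenQuotientMap_projT (n : ℕ) : IsOpenQuotientMap (projT n) :=
  (IsOpenQuotientMap.piMap fun _ => QuotientAddGroup.isOpenQuotientMap_mk).prodMap
    IsOpenQuotientMap.id

lemma IsAnglePeriodic.exists_descent {E : Type*} [TopologicalSpace E]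
    {F : (Fin n → ℝ) × (Fin n → ℝ) → E} (hF : IsAnglePeriodic F) (hc : Continuous F) :
    ∃ f : (Fin n → AddCircle (1 : ℝ)) × (Fin n → ℝ) → E,
      Continuous f ∧ ∀ p, f (projT n p) = F p := by
  have hfac : Function.FactorsThrough F (projT n) := by
    intro p q h
    obtain ⟨v, hv, rfl⟩ := projT_eq_iff.1 h
    exact hF q v hv
  have hq := isOpenQuotientMap_projT n
  let s := Function.surjInv hq.surjective
  have hs : ∀ p, F (s (projT n p)) = F p := fun p => hfac (Function.surjInv_eq hq.surjective _)
  refine ⟨F ∘ s, ?_, hs⟩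
  rw [← hq.continuous_comp_iff]
  exact hc.congr fun p => (hs p).symm

lemma IsAnglePeriodic.exists_norm_le {E : Type*} [NormedAddCommGroup E]
    {F : (Fin n → ℝ) × (Fin n → ℝ) → E} (hF : IsAnglePeriodic F) (hc : Continuous F) (R : ℝ) :
    ∃ C : ℝ, ∀ p, ‖p.2‖ ≤ R → ‖F p‖ ≤ C := by
  obtain ⟨C, hC⟩ := ((isCompact_Icc (a := (0 : Fin n → ℝ)) (b := 1)).prod
    (isCompact_closedBall (0 : Fin n → ℝ) R)).exists_bound_of_continuousOn hc.continuousOn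
  refine ⟨C, fun p hp => ?_⟩
  rw [← hF p (fun i => -(⌊p.1 i⌋ : ℝ)) fun i => ⟨-⌊p.1 i⌋, by simp⟩]
  refine hC _ ⟨⟨fun i => ?_, fun i => ?_⟩, by simpa using hp⟩
  · simpa using Int.floor_le (p.1 i)
  · have := (Int.lt_floor_add_one (p.1 i)).le
    simp only [Pi.add_apply, Pi.one_apply]
    linarith

lemma IsAnglePeriodic.fderiv {E : Type*} [NormedAddCommGroup E] [NormedSpace ℝ E]
    {F : (Fin n → ℝ) × (Fin n → ℝ) → E} (hF : IsAnglePeriodic F) :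
    IsAnglePeriodic (fderiv ℝ F) := by
  intro p v hv
  have h := fderiv_comp_add_right (𝕜 := ℝ) (f := F) (x := p) (v, 0)
  have h2 : (fun x => F (x + (v, 0))) = F := by
    funext x
    simpa [Prod.add_def] using hF x v hv
  rw [h2] at h
  simpa [Prod.add_def] using h.symm

lemma convex_norm_snd_le (R : ℝ) :
    Convex ℝ {p : (Fin n → ℝ) × (Fin n → ℝ) | ‖p.2‖ ≤ R} := by
  have h : {p : (Fin n → ℝ) × (Fin n → ℝ) | ‖p.2‖ ≤ R} = univ ×ˢ Metric.closedBall 0 R := by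
    ext p; simp
  rw [h]
  exact convex_univ.prod (convex_closedBall _ _)

lemma IsAnglePeriodic.exists_lipschitzOnWith {E : Type*} [NormedAddCommGroup E] [NormedSpace ℝ E]
    {F : (Fin n → ℝ) × (Fin n → ℝ) → E} (hF : IsAnglePeriodic F) (hc : ContDiff ℝ 1 F) (R : ℝ) :
    ∃ L : NNReal, LipschitzOnWith L F {p | ‖p.2‖ ≤ R} := by
  obtain ⟨C, hC⟩ := hF.fderiv.exists_norm_le (hc.continuous_fderiv one_ne_zero) R
  refine ⟨C.toNNReal, (convex_norm_snd_le R).lipschitzOnWith_of_nnnorm_fderiv_le (𝕜 := ℝ)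
    (fun p _ => hc.differentiable one_ne_zero p) fun p hp => ?_⟩
  rw [← NNReal.coe_le_coe, coe_nnnorm]
  exact (hC p hp).trans (Real.le_coe_toNNReal C)

end Periodic

section Gradients

variable {n : ℕ} {H : (Fin n → ℝ) → (Fin n → ℝ) → ℝ} {u : (Fin n → ℝ) → ℝ}

lemma fderiv_apply_eq_gradOf (u : (Fin n → ℝ) → ℝ) (x v : Fin n → ℝ) :
    fderiv ℝ u x v = gradOf u x ⬝ᵥ v :=
  clm_apply_eq_dotProduct _ _

lemma gradI_apply (hd : Differentiable ℝ (Function.uncurry H))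
    (p : (Fin n → ℝ) × (Fin n → ℝ)) (i : Fin n) :
    gradI H p.1 p.2 i = fderiv ℝ (Function.uncurry H) p (0, Pi.single i 1) := by
  have h : HasFDerivAt (H p.1)
      ((fderiv ℝ (Function.uncurry H) p).comp (ContinuousLinearMap.inr ℝ _ _)) p.2 :=
    HasFDerivAt.comp (g := Function.uncurry H) (f := fun I => (p.1, I)) p.2 (hd p).hasFDerivAt
      (hasFDerivAt_prodMk_right p.1 p.2)
  simp [gradI, h.fderiv]

lemma gradTheta_apply (hd : Differentiable ℝ (Function.uncurry H))
    (p : (Fin n → ℝ) × (Fin n → ℝ)) (i : Fin n) :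
    gradTheta H p.1 p.2 i = fderiv ℝ (Function.uncurry H) p (Pi.single i 1, 0) := by
  have h : HasFDerivAt (fun t => H t p.2)
      ((fderiv ℝ (Function.uncurry H) p).comp (ContinuousLinearMap.inl ℝ _ _)) p.1 :=
    HasFDerivAt.comp (g := Function.uncurry H) (f := fun t => (t, p.2)) p.1 (hd p).hasFDerivAt
      (hasFDerivAt_prodMk_left p.1 p.2)
  simp [gradTheta, h.fderiv]

lemma fderiv_uncurry_apply (hd : Differentiable ℝ (Function.uncurry H))
    (p v : (Fin n → ℝ) × (Fin n → ℝ)) :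
    fderiv ℝ (Function.uncurry H) p v =
      gradTheta H p.1 p.2 ⬝ᵥ v.1 + gradI H p.1 p.2 ⬝ᵥ v.2 := by
  have h1 := clm_apply_eq_dotProduct
    ((fderiv ℝ (Function.uncurry H) p).comp (ContinuousLinearMap.inl ℝ _ _)) v.1
  have h2 := clm_apply_eq_dotProduct
    ((fderiv ℝ (Function.uncurry H) p).comp (ContinuousLinearMap.inr ℝ _ _)) v.2
  have e1 : gradTheta H p.1 p.2 = _ := funext (gradTheta_apply hd p)
  have e2 : gradI H p.1 p.2 = _ := funext (gradI_apply hd p)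
  simp only [ContinuousLinearMap.comp_apply, ContinuousLinearMap.inl_apply,
    ContinuousLinearMap.inr_apply] at h1 h2
  rw [e1, e2, ← h1, ← h2, ← map_add]
  simp

/-- The Hamiltonian vector field. -/
noncomputable def hamField (H : (Fin n → ℝ) → (Fin n → ℝ) → ℝ)
    (p : (Fin n → ℝ) × (Fin n → ℝ)) : (Fin n → ℝ) × (Fin n → ℝ) :=
  (gradI H p.1 p.2, -gradTheta H p.1 p.2)

lemma lipschitzOnWith_hamField (hd : Differentiable ℝ (Function.uncurry H)) {L : NNReal}
    {s : Set ((Fin n → ℝ) × (Fin n → ℝ))}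
    (hL : LipschitzOnWith L (fderiv ℝ (Function.uncurry H)) s) :
    LipschitzOnWith L (hamField H) s := by
  refine LipschitzOnWith.of_dist_le_mul fun p hp q hq => ?_
  have hpq := hL.dist_le_mul p hp q hq
  have key : ∀ v : (Fin n → ℝ) × (Fin n → ℝ), ‖v‖ ≤ 1 →
      dist (fderiv ℝ (Function.uncurry H) p v) (fderiv ℝ (Function.uncurry H) q v)
        ≤ L * dist p q := by
    intro v hv
    refine le_trans ?_ hpq
    rw [dist_eq_norm, dist_eq_norm, ← sub_apply]
    exact (ContinuousLinearMap.le_opNorm _ _).trans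
      (mul_le_of_le_one_right (norm_nonneg _) hv)
  have hs : ∀ i : Fin n, ‖(Pi.single i 1 : Fin n → ℝ)‖ ≤ 1 := fun i => by
    simp [Pi.norm_single]
  rw [Prod.dist_eq]
  refine max_le ?_ ?_ <;> refine (dist_pi_le_iff (by positivity)).2 fun i => ?_
  · simp only [hamField, gradI_apply hd]
    exact key _ (by simpa [Prod.norm_def] using hs i)
  · simp only [hamField, Pi.neg_apply, dist_neg_neg, gradTheta_apply hd]
    exact key _ (by simpa [Prod.norm_def] using hs i)

lemma continuous_gradI (hH : ContDiff ℝ 1 (Function.uncurry H)) :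
    Continuous fun p : (Fin n → ℝ) × (Fin n → ℝ) => gradI H p.1 p.2 := by
  refine continuous_pi fun i => ?_
  simp only [gradI_apply (hH.differentiable one_ne_zero)]
  exact (hH.continuous_fderiv one_ne_zero).clm_apply continuous_const

lemma continuous_gradOf (hu : ContDiff ℝ 1 u) : Continuous (gradOf u) :=
  continuous_pi fun _ => (hu.continuous_fderiv one_ne_zero).clm_apply continuous_const

lemma gradOf_add_intVec (hu : ∀ x v, IsIntVec v → u (x + v) = u x) (x v : Fin n → ℝ)
    (hv : IsIntVec v) : gradOf u (x + v) = gradOf u x := by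
  have h := fderiv_comp_add_right (𝕜 := ℝ) (f := u) (x := x) v
  simp only [fun y => hu y v hv] at h
  unfold gradOf
  rw [h]

lemma LipschitzWith.fderiv_of_gradOf {K : NNReal} (hK : LipschitzWith K (gradOf u)) :
    LipschitzWith (n * K) (fderiv ℝ u) := by
  refine LipschitzWith.of_dist_le_mul fun x y => ?_
  rw [dist_eq_norm]
  refine ContinuousLinearMap.opNorm_le_bound _ (by positivity) fun v => ?_
  rw [sub_apply, fderiv_apply_eq_gradOf, fderiv_apply_eq_gradOf,
    ← sub_dotProduct]
  refine (abs_dotProduct_le _ _).trans ?_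
  have := hK.dist_le_mul x y
  rw [dist_eq_norm] at this
  push_cast
  rw [mul_assoc, mul_assoc, ← mul_assoc (K : ℝ)]
  gcongr

end Gradients

section Convexity

variable {n : ℕ}

lemma add_fderiv_lt_of_hessian_pos {f : (Fin n → ℝ) → ℝ} (hf : ContDiff ℝ 2 f)
    (hpos : ∀ I w, w ≠ 0 → 0 < iteratedFDeriv ℝ 2 f I ![w, w]) {I J : Fin n → ℝ} (hIJ : J ≠ I) :
    f I + fderiv ℝ f I (J - I) < f J := by
  have hd : Differentiable ℝ f := hf.differentiable two_ne_zero
  have hd2 : Differentiable ℝ (fderiv ℝ f) :=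
    (hf.fderiv_right (m := 1) (by norm_num)).differentiable one_ne_zero
  have hline : ∀ s : ℝ, HasDerivAt (fun s : ℝ => I + s • (J - I)) (J - I) s := fun s => by
    simpa using ((hasDerivAt_id s).smul_const (J - I)).const_add I
  have h1 : ∀ s : ℝ, HasDerivAt (fun s : ℝ => f (I + s • (J - I)))
      (fderiv ℝ f (I + s • (J - I)) (J - I)) s := fun s =>
    (hd _).hasFDerivAt.comp_hasDerivAt s (hline s)
  have h2 : ∀ s : ℝ, HasDerivAt (fun s : ℝ => fderiv ℝ f (I + s • (J - I)) (J - I))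
      (fderiv ℝ (fderiv ℝ f) (I + s • (J - I)) (J - I) (J - I)) s := fun s => by
    simpa using ((hd2 _).hasFDerivAt.comp_hasDerivAt s (hline s)).clm_apply
      (hasDerivAt_const s (J - I))
  have hmono : StrictMono fun s : ℝ => fderiv ℝ f (I + s • (J - I)) (J - I) := by
    refine strictMono_of_deriv_pos fun s => ?_
    rw [(h2 s).deriv]
    simpa [iteratedFDeriv_two_apply] using hpos (I + s • (J - I)) (J - I) (sub_ne_zero.2 hIJ)
  obtain ⟨ξ, hξ, he⟩ := exists_hasDerivAt_eq_slope _ _ zero_lt_one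
    (fun s _ => (h1 s).continuousAt.continuousWithinAt) fun s _ => h1 s
  have hlt := hmono hξ.1
  simp only [he, zero_smul, add_zero, one_smul, add_sub_cancel, sub_zero, div_one] at hlt
  linarith

end Convexity

section Energy

variable {n : ℕ} {H : (Fin n → ℝ) → (Fin n → ℝ) → ℝ}
  {φ : ℝ → (Fin n → ℝ) × (Fin n → ℝ) → (Fin n → ℝ) × (Fin n → ℝ)}
  {c : Fin n → ℝ} {u : (Fin n → ℝ) → ℝ}

lemma IsHamFlow.energy_eq (hφ : IsHamFlow H φ) (hd : Differentiable ℝ (Function.uncurry H))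
    (p : (Fin n → ℝ) × (Fin n → ℝ)) (t : ℝ) :
    Function.uncurry H (φ t p) = Function.uncurry H p := by
  have h : ∀ t, HasDerivAt (fun t => Function.uncurry H (φ t p)) 0 t := fun t => by
    have := (hd _).hasFDerivAt.comp_hasDerivAt t (hφ.2 p t)
    rw [fderiv_uncurry_apply hd] at this
    exact this.congr_deriv (by simp [dotProduct_comm])
  have := is_const_of_deriv_eq_zero (fun t => (h t).differentiableAt) (fun t => (h t).deriv) t 0
  simpa only [hφ.1] using this

/-- On a graph `I = c + ∇u(θ)` invariant under a Hamiltonian flow, the energies of two nearby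
points agree to second order: compare `u` with its linearization along two orbits. -/
lemma abs_energy_sub_le_of_invariant_graph (hφ : IsHamFlow H φ)
    (hd : Differentiable ℝ (Function.uncurry H)) (hu : Differentiable ℝ u)
    {s : Set ((Fin n → ℝ) × (Fin n → ℝ))} (hs : Convex ℝ s) {L M : NNReal}
    (hL : LipschitzOnWith L (fderiv ℝ (Function.uncurry H)) s)
    (hM : LipschitzWith M (fderiv ℝ u)) {p q : (Fin n → ℝ) × (Fin n → ℝ)}
    (hp : ∀ t, φ t p ∈ s) (hq : ∀ t, φ t q ∈ s)
    (hpu : ∀ t, (φ t p).2 = c + gradOf u (φ t p).1)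
    (hqu : ∀ t, (φ t q).2 = c + gradOf u (φ t q).1) :
    |Function.uncurry H q - Function.uncurry H p| ≤
      (2 * M + L + n * L) * (‖q - p‖ * Real.exp L) ^ 2 := by
  have hX := lipschitzOnWith_hamField hd hL
  set B := ‖q - p‖ * Real.exp L with hB
  have hder : ∀ p t, HasDerivAt (fun τ => φ τ p) (hamField H (φ t p)) t := hφ.2
  have hgron : ∀ t ∈ Icc (0 : ℝ) 1, ‖φ t q - φ t p‖ ≤ B := by
    intro t ht
    have := dist_le_of_trajectories_ODE_of_mem (v := fun _ => hamField H) (s := fun _ => s)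
      (K := L) (f := fun t => φ t q) (g := fun t => φ t p) (a := 0) (b := 1) (δ := ‖q - p‖)
      (fun _ _ => hX) (fun t _ => (hder q t).continuousAt.continuousWithinAt)
      (fun t _ => (hder q t).hasDerivWithinAt) (fun t _ => hq t)
      (fun t _ => (hder p t).continuousAt.continuousWithinAt)
      (fun t _ => (hder p t).hasDerivWithinAt) (fun t _ => hp t)
      (by simp only [hφ.1, dist_eq_norm, le_refl]) t ht
    rw [dist_eq_norm] at this
    refine this.trans ?_
    rw [hB]
    gcongr
    simpa using mul_le_of_le_one_right L.2 ht.2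
  set F : ℝ → ℝ := fun t => u (φ t q).1 - u (φ t p).1 -
    ((φ t p).2 - c) ⬝ᵥ ((φ t q).1 - (φ t p).1) with hF
  have hFle : ∀ t ∈ Icc (0 : ℝ) 1, |F t| ≤ M * B ^ 2 := by
    intro t ht
    have h := norm_image_sub_fderiv_le convex_univ hu hM.lipschitzOnWith
      (mem_univ (φ t p).1) (mem_univ (φ t q).1)
    rw [fderiv_apply_eq_gradOf, ← sub_eq_of_eq_add' (hpu t)] at h
    refine h.trans ?_
    gcongr
    exact (norm_fst_le (φ t q - φ t p)).trans (hgron t ht)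
  have hFder : ∀ t, HasDerivAt F (fderiv ℝ (Function.uncurry H) (φ t p) (φ t q - φ t p) +
      ((φ t q).2 - (φ t p).2) ⬝ᵥ ((hamField H (φ t q)).1 - (hamField H (φ t p)).1)) t := by
    intro t
    have hp1 : HasDerivAt (fun τ => (φ τ p).1) (hamField H (φ t p)).1 t := (hder p t).fst
    have hq1 : HasDerivAt (fun τ => (φ τ q).1) (hamField H (φ t q)).1 t := (hder q t).fst
    have hp2 : HasDerivAt (fun τ => (φ τ p).2) (hamField H (φ t p)).2 t := (hder p t).snd
    have h1 := (hu _).hasFDerivAt.comp_hasDerivAt t hq1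
    have h2 := (hu _).hasFDerivAt.comp_hasDerivAt t hp1
    have h3 := hasDerivAt_dotProduct (hp2.sub_const c) (HasDerivAt.fun_sub hq1 hp1)
    refine ((h1.sub h2).sub h3).congr_deriv ?_
    rw [fderiv_apply_eq_gradOf, fderiv_apply_eq_gradOf, fderiv_uncurry_apply hd,
      ← sub_eq_of_eq_add' (hpu t), ← sub_eq_of_eq_add' (hqu t)]
    simp only [hamField, Prod.fst_sub, Prod.snd_sub, sub_dotProduct,
      dotProduct_sub, neg_dotProduct]
    simp only [dotProduct_comm (gradI H (φ t p).1 (φ t p).2)]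
    ring
  obtain ⟨ξ, hξ, he⟩ := exists_hasDerivAt_eq_slope F _ zero_lt_one
    (fun t _ => (hFder t).continuousAt.continuousWithinAt) fun t _ => hFder t
  have hξ' : ξ ∈ Icc (0 : ℝ) 1 := Ioo_subset_Icc_self hξ
  have hδ := hgron ξ hξ'
  have hH := norm_image_sub_fderiv_le hs hd hL (hp ξ) (hq ξ)
  rw [hφ.energy_eq hd, hφ.energy_eq hd] at hH
  have hH' : (L : ℝ) * ‖φ ξ q - φ ξ p‖ ^ 2 ≤ L * B ^ 2 := by gcongr
  have hdot : |((φ ξ q).2 - (φ ξ p).2) ⬝ᵥ ((hamField H (φ ξ q)).1 - (hamField H (φ ξ p)).1)|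
      ≤ n * L * B ^ 2 := by
    refine (abs_dotProduct_le _ _).trans ?_
    have a1 : ‖(φ ξ q).2 - (φ ξ p).2‖ ≤ B := (norm_snd_le (φ ξ q - φ ξ p)).trans hδ
    have a2 : ‖(hamField H (φ ξ q)).1 - (hamField H (φ ξ p)).1‖ ≤ L * B := by
      refine (norm_fst_le (hamField H (φ ξ q) - hamField H (φ ξ p))).trans ?_
      refine (hX.norm_sub_le (hq ξ) (hp ξ)).trans ?_
      gcongr
    calc (n : ℝ) * (_ * _) ≤ n * (B * (L * B)) := by gcongr
      _ = n * L * B ^ 2 := by ring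
  have f0 := hFle 0 (by simp)
  have f1 := hFle 1 (by simp)
  simp only [sub_zero, div_one] at he
  rw [abs_le] at *
  constructor <;> linarith [hH.1, hH.2, hdot.1, hdot.2, f0.1, f0.2, f1.1, f1.2]

/-- The Hamiltonian is constant on an invariant Lipschitz Lagrangian graph. -/
lemma exists_energy_of_invariant_graph (hφ : IsHamFlow H φ)
    (hH : ContDiff ℝ 2 (Function.uncurry H)) (hper : IsAnglePeriodic (Function.uncurry H))
    (hu : IsC1LipGrad u)
    (hinv : ∀ t x, (φ t (x, c + gradOf u x)).2 = c + gradOf u (φ t (x, c + gradOf u x)).1) :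
    ∃ α, ∀ x, H x (c + gradOf u x) = α := by
  obtain ⟨huper, hu1, K, hK⟩ := hu
  have hd := hH.differentiable two_ne_zero
  have hψper : IsAnglePeriodic fun p : (Fin n → ℝ) × (Fin n → ℝ) => c + gradOf u p.1 :=
    fun p v hv => by simp only [gradOf_add_intVec huper _ v hv]
  obtain ⟨R, hR⟩ := hψper.exists_norm_le
    (continuous_const.add ((continuous_gradOf hu1).comp continuous_fst)) 0
  obtain ⟨L, hL⟩ := hper.fderiv.exists_lipschitzOnWith
    (hH.fderiv_right (m := 1) (by norm_num)) R
  have hmem : ∀ x t, φ t (x, c + gradOf u x) ∈ {p : (Fin n → ℝ) × (Fin n → ℝ) | ‖p.2‖ ≤ R} :=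
    fun x t => by
      rw [mem_ofPred_eq, hinv]
      exact hR (_, 0) (by simp)
  obtain ⟨C, hC⟩ : ∃ C : ℝ, ∀ x y, |H y (c + gradOf u y) - H x (c + gradOf u x)| ≤
      C * ‖y - x‖ ^ 2 := by
    refine ⟨(2 * (n * K : NNReal) + L + n * L) * ((1 + K) * Real.exp L) ^ 2, fun x y => ?_⟩
    refine (abs_energy_sub_le_of_invariant_graph hφ hd (hu1.differentiable one_ne_zero)
      (convex_norm_snd_le R) hL hK.fderiv_of_gradOf (hmem x) (hmem y)
      (fun t => hinv t x) fun t => hinv t y).trans ?_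
    have hK' := hK.norm_sub_le y x
    have hle : ‖(y, c + gradOf u y) - (x, c + gradOf u x)‖ ≤ (1 + K) * ‖y - x‖ := by
      rw [Prod.norm_def]
      refine max_le ?_ ?_
      · simp only [Prod.fst_sub]
        nlinarith [norm_nonneg (y - x), K.2]
      · simp only [Prod.snd_sub, add_sub_add_left_eq_sub]
        nlinarith [norm_nonneg (y - x)]
    rw [mul_assoc, ← mul_pow, mul_right_comm (1 + (K : ℝ))]
    gcongr
  have hfd : ∀ x, HasFDerivAt (fun y => H y (c + gradOf u y)) (0 : (Fin n → ℝ) →L[ℝ] ℝ) x := by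
    intro x
    have h : HasFDerivAt (fun y => H y (c + gradOf u y) - H x (c + gradOf u x))
        (0 : (Fin n → ℝ) →L[ℝ] ℝ) x := by
      refine Asymptotics.IsBigO.hasFDerivAt (n := 2) ?_ one_lt_two
      refine Asymptotics.IsBigO.of_bound C (Eventually.of_forall fun y => ?_)
      simpa using hC x y
    simpa using h.add_const (H x (c + gradOf u x))
  exact ⟨_, fun x => is_const_of_fderiv_eq_zero (fun x => (hfd x).differentiableAt)
    (fun x => (hfd x).fderiv) x 0⟩

end Energy

section Measures

variable {n : ℕ} {H : (Fin n → ℝ) → (Fin n → ℝ) → ℝ}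
  {φ : ℝ → (Fin n → ℝ) × (Fin n → ℝ) → (Fin n → ℝ) × (Fin n → ℝ)}
  {Φ : ℝ → (Fin n → AddCircle (1 : ℝ)) × (Fin n → ℝ) →
    (Fin n → AddCircle (1 : ℝ)) × (Fin n → ℝ)}
  {c : Fin n → ℝ} {u : (Fin n → ℝ) → ℝ}

lemma projT_mem_lagGraph_iff (hu : ∀ x v, IsIntVec v → u (x + v) = u x)
    {p : (Fin n → ℝ) × (Fin n → ℝ)} :
    projT n p ∈ lagGraph c u ↔ p.2 = c + gradOf u p.1 := by
  refine ⟨?_, fun h => ⟨p, h, rfl⟩⟩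
  rintro ⟨q, hq, hqp⟩
  obtain ⟨v, hv, rfl⟩ := projT_eq_iff.1 hqp
  simpa only [mem_ofPred_eq, gradOf_add_intVec hu _ v hv] using hq

lemma isClosed_lagGraph (hu : ∀ x v, IsIntVec v → u (x + v) = u x) (hu1 : ContDiff ℝ 1 u) :
    IsClosed (lagGraph c u) := by
  rw [← (isOpenQuotientMap_projT n).isQuotientMap.isClosed_preimage]
  have h : projT n ⁻¹' lagGraph c u = {p | p.2 = c + gradOf u p.1} := by
    ext p
    exact projT_mem_lagGraph_iff hu
  rw [h]
  exact isClosed_eq continuous_snd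
    (continuous_const.add ((continuous_gradOf hu1).comp continuous_fst))

lemma flow_snd_eq_of_invariant_lagGraph (hΦ : ∀ t p, Φ t (projT n p) = projT n (φ t p))
    (hu : ∀ x v, IsIntVec v → u (x + v) = u x)
    (hinv : ∀ t, Φ t '' lagGraph c u = lagGraph c u) (t : ℝ) (x : Fin n → ℝ) :
    (φ t (x, c + gradOf u x)).2 = c + gradOf u (φ t (x, c + gradOf u x)).1 := by
  rw [← projT_mem_lagGraph_iff hu, ← hΦ, ← hinv t]
  exact mem_image_of_mem _ ((projT_mem_lagGraph_iff hu).2 rfl)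

/-- Invariant measures are closed: the derivative of a periodic function along the flow, if
bounded on the orbits carrying the measure, has zero mean. -/
lemma integral_deriv_along_flow_eq_zero (hφ : IsHamFlow H φ)
    (hΦcont : ∀ t, Continuous (Φ t)) (hΦ : ∀ t p, Φ t (projT n p) = projT n (φ t p))
    {w : (Fin n → ℝ) → ℝ} (hw : ∀ x v, IsIntVec v → w (x + v) = w x) (hw1 : ContDiff ℝ 1 w)
    {μ : Measure ((Fin n → AddCircle (1 : ℝ)) × (Fin n → ℝ))} [IsProbabilityMeasure μ]
    (hμ : ∀ t, μ.map (Φ t) = μ)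
    {D : (Fin n → AddCircle (1 : ℝ)) × (Fin n → ℝ) → ℝ} (hDc : Continuous D)
    (hD : ∀ p, D (projT n p) = gradOf w p.1 ⬝ᵥ gradI H p.1 p.2)
    {C : ℝ} (hC : ∀ᵐ q ∂μ, ∀ t, ‖D (Φ t q)‖ ≤ C) :
    ∫ q, D q ∂μ = 0 := by
  have hwper : IsAnglePeriodic fun p : (Fin n → ℝ) × (Fin n → ℝ) => w p.1 :=
    fun p v hv => hw p.1 v hv
  have hwc : Continuous fun p : (Fin n → ℝ) × (Fin n → ℝ) => w p.1 :=
    hw1.continuous.comp continuous_fst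
  obtain ⟨f, hfc, hf⟩ := hwper.exists_descent hwc
  obtain ⟨B, hB⟩ := hwper.exists_norm_le hwc 0
  have hsurj := (isOpenQuotientMap_projT n).surjective
  have hfB : ∀ q, ‖f q‖ ≤ B := fun q => by
    obtain ⟨p, rfl⟩ := hsurj q
    rw [hf]
    exact hB (p.1, 0) (by simp)
  have hΦ0 : ∀ q, Φ 0 q = q := fun q => by
    obtain ⟨p, rfl⟩ := hsurj q
    rw [hΦ, hφ.1]
  have hder : ∀ q t, HasDerivAt (fun t => f (Φ t q)) (D (Φ t q)) t := fun q t => by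
    obtain ⟨p, rfl⟩ := hsurj q
    simp only [hΦ, hf, hD, ← fderiv_apply_eq_gradOf]
    exact (hw1.differentiable one_ne_zero _).hasFDerivAt.comp_hasDerivAt t (hφ.2 p t).fst
  have hint : HasDerivAt (fun t => ∫ q, f (Φ t q) ∂μ) (∫ q, D (Φ 0 q) ∂μ) 0 :=
    (hasDerivAt_integral_of_dominated_loc_of_deriv_le (bound := fun _ => C) univ_mem
      (Eventually.of_forall fun t => (hfc.comp (hΦcont t)).aestronglyMeasurable)
      (Integrable.of_bound (hfc.comp (hΦcont 0)).aestronglyMeasurable B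
        (Eventually.of_forall fun q => hfB _))
      (hDc.comp (hΦcont 0)).aestronglyMeasurable
      (hC.mono fun q hq t _ => hq t) (integrable_const C)
      (Eventually.of_forall fun q t _ => hder q t)).2
  have hconst : ∀ t, ∫ q, f (Φ t q) ∂μ = ∫ q, f q ∂μ := fun t => by
    rw [← integral_map (hΦcont t).aemeasurable hfc.aestronglyMeasurable, hμ]
  simp only [hconst, hΦ0] at hint
  exact hint.unique (hasDerivAt_const _ _)

/-- If two Lagrangian graphs with constant energies `α₀`, `α₁` differ and the first is
Schwartzman strictly ergodic with rotation vector `ω`, then the energies satisfy a strict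
convexity inequality with subgradient `ω`. -/
lemma rotation_dotProduct_lt_energy_sub (hH : IsTonelli H) (hφ : IsHamFlow H φ)
    (hΦcont : ∀ t, Continuous (Φ t)) (hΦ : ∀ t p, Φ t (projT n p) = projT n (φ t p))
    {ω c₀ c₁ : Fin n → ℝ} {u₀ u₁ : (Fin n → ℝ) → ℝ} (hu₀ : IsC1LipGrad u₀)
    (hu₁ : IsC1LipGrad u₁) (hinv : ∀ t, Φ t '' lagGraph c₀ u₀ = lagGraph c₀ u₀)
    (hse : SchwartzmanStrictlyErgodic H Φ (lagGraph c₀ u₀) ω) {α₀ α₁ : ℝ}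
    (hα₀ : ∀ x, H x (c₀ + gradOf u₀ x) = α₀) (hα₁ : ∀ x, H x (c₁ + gradOf u₁ x) = α₁)
    {x₀ : Fin n → ℝ} (hne : c₁ + gradOf u₁ x₀ ≠ c₀ + gradOf u₀ x₀) :
    ω ⬝ᵥ (c₁ - c₀) < α₁ - α₀ := by
  obtain ⟨hsm, hper, ⟨κ, hκ, hhess⟩, -⟩ := hH
  obtain ⟨hp₀, h₀, -⟩ := hu₀
  obtain ⟨hp₁, h₁, -⟩ := hu₁
  obtain ⟨hrot, μ, hμprob, hμinv, hμT, hμsupp⟩ := hse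
  have hsm2 : ContDiff ℝ 2 (Function.uncurry H) := contDiff_infty.1 hsm 2
  have hsm1 : ContDiff ℝ 1 (Function.uncurry H) := hsm2.of_le one_le_two
  have hc₀ := continuous_gradOf h₀
  have hTae : ∀ᵐ q ∂μ, q ∈ lagGraph c₀ u₀ :=
    (mem_ae_iff_prob_eq_one (isClosed_lagGraph hp₀ h₀).measurableSet).2 hμT
  have hgper : IsAnglePeriodic fun p : (Fin n → ℝ) × (Fin n → ℝ) => gradI H p.1 p.2 := by
    intro p v hv
    have h : H (p.1 + v) = H p.1 := funext fun I => hper _ _ _ hv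
    unfold gradI
    simp only [h]
  have hgc := continuous_gradI hsm1
  obtain ⟨R, hR⟩ : ∃ R, ∀ x, ‖c₀ + gradOf u₀ x‖ ≤ R := by
    have hψ : IsAnglePeriodic fun p : (Fin n → ℝ) × (Fin n → ℝ) => c₀ + gradOf u₀ p.1 :=
      fun p v hv => by simp only [gradOf_add_intVec hp₀ _ v hv]
    obtain ⟨R, hR⟩ := hψ.exists_norm_le
      (continuous_const.add (hc₀.comp continuous_fst)) 0
    exact ⟨R, fun x => hR (x, 0) (by simp)⟩
  -- descend `∇_I H` and `∇w · ∇_I H` with `w = u₁ - u₀`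
  obtain ⟨g, hgcont, hg⟩ := hgper.exists_descent hgc
  set w : (Fin n → ℝ) → ℝ := fun x => u₁ x - u₀ x with hw
  have hwper : ∀ x v, IsIntVec v → w (x + v) = w x := fun x v hv => by
    simp only [hw, hp₀ x v hv, hp₁ x v hv]
  have hw1 : ContDiff ℝ 1 w := h₁.sub h₀
  have hgw : ∀ x, gradOf w x = gradOf u₁ x - gradOf u₀ x := fun x => by
    funext i
    simp [gradOf, hw, fderiv_fun_sub (h₁.differentiable one_ne_zero x)
      (h₀.differentiable one_ne_zero x)]
  have hDper : IsAnglePeriodic fun p : (Fin n → ℝ) × (Fin n → ℝ) =>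
      gradOf w p.1 ⬝ᵥ gradI H p.1 p.2 := fun p v hv => by
    have := hgper p v hv
    simp only at this
    simp only [gradOf_add_intVec hwper _ v hv, this]
  have hDc' : Continuous fun p : (Fin n → ℝ) × (Fin n → ℝ) => gradOf w p.1 ⬝ᵥ gradI H p.1 p.2 :=
    ((continuous_gradOf hw1).comp continuous_fst).dotProduct hgc
  obtain ⟨D, hDcont, hD⟩ := hDper.exists_descent hDc'
  have hbound : ∀ {E : Type} [NormedAddCommGroup E]
      {F : (Fin n → ℝ) × (Fin n → ℝ) → E} {f : (Fin n → AddCircle (1 : ℝ)) × (Fin n → ℝ) → E},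
      IsAnglePeriodic F → Continuous F → (∀ p, f (projT n p) = F p) →
      ∃ C : ℝ, ∀ q ∈ lagGraph c₀ u₀, ‖f q‖ ≤ C := by
    intro E _ F f hF hFc hf
    obtain ⟨C, hC⟩ := hF.exists_norm_le hFc R
    refine ⟨C, ?_⟩
    rintro q ⟨p, hp, rfl⟩
    rw [mem_ofPred_eq] at hp
    rw [hf]
    exact hC p (hp ▸ hR p.1)
  obtain ⟨Cg, hCg⟩ := hbound hgper hgc hg
  obtain ⟨CD, hCD⟩ := hbound hDper hDc' hD
  have hgint : Integrable g μ :=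
    Integrable.of_bound hgcont.aestronglyMeasurable Cg (hTae.mono hCg)
  have hDint : Integrable D μ :=
    Integrable.of_bound hDcont.aestronglyMeasurable CD (hTae.mono hCD)
  have hD0 : ∫ q, D q ∂μ = 0 :=
    integral_deriv_along_flow_eq_zero hφ hΦcont hΦ hwper hw1 hμinv hDcont hD
      (hTae.mono fun q hq t => hCD _ (hinv t ▸ mem_image_of_mem _ hq))
  have hgω : ∫ q, g q ∂μ = ω := hrot μ hμprob hμinv hμT g hgcont hg
  have hgi : ∀ i, Integrable (fun q => g q i) μ := fun i => hgint.eval i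
  have hgcint : Integrable (fun q => g q ⬝ᵥ (c₁ - c₀)) μ :=
    integrable_finsetSum _ fun i _ => (hgi i).mul_const _
  have hgcω : ∫ q, g q ⬝ᵥ (c₁ - c₀) ∂μ = ω ⬝ᵥ (c₁ - c₀) := by
    simp only [dotProduct]
    rw [integral_finsetSum _ fun i _ => (hgi i).mul_const _]
    refine Finset.sum_congr rfl fun i _ => ?_
    rw [integral_mul_const, ← hgω, eval_integral hgi]
  -- the convexity defect
  set k : (Fin n → AddCircle (1 : ℝ)) × (Fin n → ℝ) → ℝ :=
    fun q => α₁ - α₀ - (g q ⬝ᵥ (c₁ - c₀) + D q) with hk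
  have hkc : Continuous k :=
    continuous_const.sub ((hgcont.dotProduct continuous_const).add hDcont)
  have hkint : Integrable k μ := (integrable_const _).sub (hgcint.add hDint)
  have hkval : ∫ q, k q ∂μ = α₁ - α₀ - ω ⬝ᵥ (c₁ - c₀) := by
    simp only [hk]
    rw [integral_sub (integrable_const _) (Integrable.fun_add hgcint hDint),
      integral_add hgcint hDint, hD0, hgcω]
    simp
  have hkproj : ∀ x, k (projT n (x, c₀ + gradOf u₀ x)) = H x (c₁ + gradOf u₁ x) -
      (H x (c₀ + gradOf u₀ x) + fderiv ℝ (H x) (c₀ + gradOf u₀ x)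
        (c₁ + gradOf u₁ x - (c₀ + gradOf u₀ x))) := by
    intro x
    have e : fderiv ℝ (H x) (c₀ + gradOf u₀ x) (c₁ + gradOf u₁ x - (c₀ + gradOf u₀ x)) =
        gradI H x (c₀ + gradOf u₀ x) ⬝ᵥ (c₁ + gradOf u₁ x - (c₀ + gradOf u₀ x)) :=
      clm_apply_eq_dotProduct _ _
    rw [e, hα₀, hα₁]
    simp only [hk, hg, hD, hgw, dotProduct_comm _ (gradI H x (c₀ + gradOf u₀ x)), dotProduct_sub,
      dotProduct_add]
    ring
  have hkpos : ∀ x, c₁ + gradOf u₁ x ≠ c₀ + gradOf u₀ x →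
      0 < k (projT n (x, c₀ + gradOf u₀ x)) := by
    intro x hx
    rw [hkproj, sub_pos]
    refine add_fderiv_lt_of_hessian_pos (hsm2.comp (contDiff_prodMk_right x))
      (fun I v hv => lt_of_lt_of_le ?_ (hhess x I v)) hx
    have := norm_pos_iff.2 hv
    positivity
  have hknn : ∀ q ∈ lagGraph c₀ u₀, 0 ≤ k q := by
    rintro q ⟨⟨x, I⟩, hp, rfl⟩
    obtain rfl : I = c₀ + gradOf u₀ x := hp
    by_cases hx : c₁ + gradOf u₁ x = c₀ + gradOf u₀ x
    · rw [hkproj, hx]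
      simp
    · exact (hkpos x hx).le
  have hpos : 0 < ∫ q, k q ∂μ := by
    rw [integral_pos_iff_support_of_nonneg_ae (hTae.mono hknn) hkint]
    exact hμsupp _ hkc.isOpen_support
      ⟨_, (hkpos x₀ hne).ne', (projT_mem_lagGraph_iff hp₀).2 rfl⟩
  linarith [hkval]

end Measures

/-- Fathi–Giuliani–Sorrentino.  Two Lipschitz Lagrangian
graphs invariant under the flow of a Tonelli Hamiltonian, both Schwartzman
strictly ergodic with the same rotation vector `ω`, coincide. -/
theorem uniqueness_of_schwartzman_ergodic_lagrangian_graphs {n : ℕ}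
    (H : (Fin n → ℝ) → (Fin n → ℝ) → ℝ) (hH : IsTonelli H)
    (φ : ℝ → (Fin n → ℝ) × (Fin n → ℝ) → (Fin n → ℝ) × (Fin n → ℝ))
    (hφ : IsHamFlow H φ)
    (Φ : ℝ → (Fin n → AddCircle (1:ℝ)) × (Fin n → ℝ) →
      (Fin n → AddCircle (1:ℝ)) × (Fin n → ℝ))
    (hΦcont : ∀ t, Continuous (Φ t))
    (hΦ : ∀ t p, Φ t (projT n p) = projT n (φ t p))
    (ω : Fin n → ℝ)
    (c₀ : Fin n → ℝ) (u₀ : (Fin n → ℝ) → ℝ) (hu₀ : IsC1LipGrad u₀)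
    (c₁ : Fin n → ℝ) (u₁ : (Fin n → ℝ) → ℝ) (hu₁ : IsC1LipGrad u₁)
    (hinv₀ : ∀ t, Φ t '' lagGraph c₀ u₀ = lagGraph c₀ u₀)
    (hinv₁ : ∀ t, Φ t '' lagGraph c₁ u₁ = lagGraph c₁ u₁)
    (hse₀ : SchwartzmanStrictlyErgodic H Φ (lagGraph c₀ u₀) ω)
    (hse₁ : SchwartzmanStrictlyErgodic H Φ (lagGraph c₁ u₁) ω) :
    lagGraph c₀ u₀ = lagGraph c₁ u₁ := by
  obtain ⟨hsm, hper, -⟩ := id hH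
  have hsm2 : ContDiff ℝ 2 (Function.uncurry H) := contDiff_infty.1 hsm 2
  have hHper : IsAnglePeriodic (Function.uncurry H) := fun p v hv => hper p.1 p.2 v hv
  obtain ⟨α₀, hα₀⟩ := exists_energy_of_invariant_graph hφ hsm2 hHper hu₀
    (flow_snd_eq_of_invariant_lagGraph hΦ hu₀.1 hinv₀)
  obtain ⟨α₁, hα₁⟩ := exists_energy_of_invariant_graph hφ hsm2 hHper hu₁
    (flow_snd_eq_of_invariant_lagGraph hΦ hu₁.1 hinv₁)
  have heq : ∀ x, c₀ + gradOf u₀ x = c₁ + gradOf u₁ x := by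
    by_contra! hne
    obtain ⟨x, hx⟩ := hne
    have h₀ := rotation_dotProduct_lt_energy_sub hH hφ hΦcont hΦ hu₀ hu₁ hinv₀ hse₀ hα₀ hα₁ hx.symm
    have h₁ := rotation_dotProduct_lt_energy_sub hH hφ hΦcont hΦ hu₁ hu₀ hinv₁ hse₁ hα₁ hα₀ hx
    simp only [dotProduct_sub] at h₀ h₁
    linarith
  simp only [lagGraph, heq]
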